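/- arXiv:1106.4895 — 2 statements merged into one kernel-verified Lean document; each statement's English description precedes it below -/
import Mathlib

section
/- Let Λ ⊂ ℝ² be a lattice and set h₁(x,y) = x² − y², h₂(x,y) = xy. Then on the upper half plane: (1/(2πi))·(Θ_{h₁;Λ}(τ)·Θ′_{h₂;Λ}(τ) − Θ′_{h₁;Λ}(τ)·Θ_{h₂;Λ}(τ)) = (1/2)·Σ_{(λ,μ)∈Λ×Λ} ⟨λ,μ⟩·det(λ,μ)·(‖μ‖² − ‖λ‖²)·q^{‖λ‖²+‖μ‖²}, where q = exp(2πiτ), Θ′ denotes d/dτ, and det(λ,μ) = λ₁μ₂ − λ₂μ₁. -/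
open scoped BigOperators

noncomputable section

/-- The standard Euclidean inner product on `ℝ²`. -/
def ip (v w : Fin 2 → ℝ) : ℝ := ∑ i, v i * w i

/-- The squared Euclidean norm on `ℝ²`. -/
def nsq (v : Fin 2 → ℝ) : ℝ := ∑ i, v i ^ 2

/-- `det(λ,μ) = λ₁μ₂ − λ₂μ₁`. -/
def det2 (v w : Fin 2 → ℝ) : ℝ := v 0 * w 1 - v 1 * w 0

/-- `q^t = exp(2 π i t τ)`. -/
def eq2 (t : ℝ) (τ : ℂ) : ℂ := Complex.exp (2 * Real.pi * Complex.I * t * τ)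

/-- The lattice vector `Σᵢ cᵢ bᵢ` attached to the integer coefficient vector `c`. -/
def LV (b : Fin 2 → Fin 2 → ℝ) (c : Fin 2 → ℤ) : Fin 2 → ℝ :=
  ∑ i, (c i : ℝ) • b i

/-- The theta series `Θ_{h;Λ}` with polynomial coefficient `h` of the lattice spanned
by `b`, as a function of `τ ∈ ℍ`. -/
def thetaP (b : Fin 2 → Fin 2 → ℝ) (h : (Fin 2 → ℝ) → ℝ) (τ : ℂ) : ℂ :=
  ∑' c : Fin 2 → ℤ, ((h (LV b c) : ℝ) : ℂ) * eq2 (nsq (LV b c)) τ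

lemma nsq_nonneg (v : Fin 2 → ℝ) : 0 ≤ nsq v :=
  Finset.sum_nonneg fun _ _ => sq_nonneg _

lemma sq_norm_le_nsq (v : Fin 2 → ℝ) : ‖v‖ ^ 2 ≤ nsq v := by
  obtain ⟨i, hi⟩ := Finite.exists_max fun i => ‖v i‖
  have hv : ‖v‖ ≤ ‖v i‖ := (pi_norm_le_iff_of_nonneg (norm_nonneg _)).2 hi
  calc ‖v‖ ^ 2 ≤ ‖v i‖ ^ 2 := by gcongr
    _ = v i ^ 2 := by rw [Real.norm_eq_abs, sq_abs]
    _ ≤ nsq v :=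
      Finset.single_le_sum (f := fun j => v j ^ 2) (fun j _ => sq_nonneg _) (Finset.mem_univ i)

lemma exists_sq_norm_le_nsq_LV {b : Fin 2 → Fin 2 → ℝ} (hb : LinearIndependent ℝ b) :
    ∃ C : ℝ, 0 ≤ C ∧ ∀ c : Fin 2 → ℤ, ‖c‖ ^ 2 ≤ C * nsq (LV b c) := by
  obtain ⟨K, -, hK⟩ := LinearMap.exists_antilipschitzWith (Fintype.linearCombination ℝ b)
    (Fintype.linearIndependent_iff'.1 hb)
  refine ⟨(K : ℝ) ^ 2, by positivity, fun c => ?_⟩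
  have hc : ‖c‖ = ‖fun i => (c i : ℝ)‖ := by
    simp [Pi.norm_def, Int.norm_eq_abs, nnnorm]
  have h := hK.le_mul_norm (map_zero _) (fun i => (c i : ℝ))
  rw [hc]
  calc ‖fun i => (c i : ℝ)‖ ^ 2 ≤ (K * ‖LV b c‖) ^ 2 := by gcongr; exact h
    _ = K ^ 2 * ‖LV b c‖ ^ 2 := mul_pow ..
    _ ≤ K ^ 2 * nsq (LV b c) := by gcongr; exact sq_norm_le_nsq _

lemma pow_three_mul_exp_neg_le {a : ℝ} (ha : 0 < a) {t : ℝ} (ht : 0 ≤ t) :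
    t ^ 3 * Real.exp (-(a * t)) ≤ 6 / a ^ 3 := by
  have h := Real.pow_div_factorial_le_exp (a * t) (by positivity) 3
  rw [Real.exp_neg, ← div_eq_mul_inv, div_le_div_iff₀ (Real.exp_pos _) (by positivity)]
  norm_num [Nat.factorial] at h
  nlinarith

lemma summable_nsq_mul_exp {b : Fin 2 → Fin 2 → ℝ} (hb : LinearIndependent ℝ b)
    {a : ℝ} (ha : 0 < a) :
    Summable fun c : Fin 2 → ℤ => nsq (LV b c) * Real.exp (-(a * nsq (LV b c))) := by
  obtain ⟨C, hC, hle⟩ := exists_sq_norm_le_nsq_LV hb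
  refine ((EisensteinSeries.summable_one_div_norm_rpow (k := 4) (by norm_num)).mul_left
    (C ^ 2 * (6 / a ^ 3))).of_nonneg_of_le
    (fun c => mul_nonneg (nsq_nonneg _) (Real.exp_pos _).le) fun c => ?_
  rcases eq_or_ne c 0 with rfl | hc
  · have h0 : nsq (LV b 0) = 0 := by simp [nsq, LV]
    rw [h0, zero_mul]
    positivity
  have hpos : 0 < ‖c‖ := norm_pos_iff.2 hc
  have hN := nsq_nonneg (LV b c)
  have hrpow : ‖c‖ ^ (-4 : ℝ) = (‖c‖ ^ 4)⁻¹ := by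
    rw [Real.rpow_neg hpos.le]; norm_cast
  rw [hrpow, ← div_eq_mul_inv, le_div_iff₀ (by positivity)]
  calc nsq (LV b c) * Real.exp (-(a * nsq (LV b c))) * ‖c‖ ^ 4
      = nsq (LV b c) * Real.exp (-(a * nsq (LV b c))) * (‖c‖ ^ 2) ^ 2 := by ring
    _ ≤ nsq (LV b c) * Real.exp (-(a * nsq (LV b c))) * (C * nsq (LV b c)) ^ 2 := by
        gcongr; exact hle c
    _ = C ^ 2 * (nsq (LV b c) ^ 3 * Real.exp (-(a * nsq (LV b c)))) := by ring
    _ ≤ C ^ 2 * (6 / a ^ 3) := by gcongr; exact pow_three_mul_exp_neg_le ha hN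

lemma eq2_add (s t : ℝ) (τ : ℂ) : eq2 (s + t) τ = eq2 s τ * eq2 t τ := by
  simp only [eq2, ← Complex.exp_add]
  push_cast
  ring_nf

lemma norm_eq2 (t : ℝ) (τ : ℂ) : ‖eq2 t τ‖ = Real.exp (-(2 * Real.pi * τ.im * t)) := by
  rw [eq2, Complex.norm_exp]
  congr 1
  simp [Complex.mul_re, Complex.mul_im]
  ring

lemma hasDerivAt_eq2 (t : ℝ) (τ : ℂ) :
    HasDerivAt (eq2 t) (2 * Real.pi * Complex.I * (t * eq2 t τ)) τ := by
  have h := ((hasDerivAt_id τ).const_mul (2 * Real.pi * Complex.I * t : ℂ)).cexp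
  convert! h using 1
  simp only [eq2, id]
  ring

lemma norm_theta_term_le {h : (Fin 2 → ℝ) → ℝ} (hh : ∀ v, |h v| ≤ nsq v) (v : Fin 2 → ℝ)
    {δ : ℝ} {τ : ℂ} (hτ : δ ≤ τ.im) :
    ‖(h v : ℂ) * eq2 (nsq v) τ‖ ≤ nsq v * Real.exp (-(2 * Real.pi * δ * nsq v)) := by
  have hN := nsq_nonneg v
  rw [norm_mul, Complex.norm_real, Real.norm_eq_abs, norm_eq2]
  gcongr
  exact hh v

lemma summable_norm_theta_term {b : Fin 2 → Fin 2 → ℝ} (hb : LinearIndependent ℝ b)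
    {h : (Fin 2 → ℝ) → ℝ} (hh : ∀ v, |h v| ≤ nsq v) {τ : ℂ} (hτ : 0 < τ.im) :
    Summable fun c : Fin 2 → ℤ => ‖(h (LV b c) : ℂ) * eq2 (nsq (LV b c)) τ‖ :=
  (summable_nsq_mul_exp hb (by positivity : 0 < 2 * Real.pi * τ.im)).of_nonneg_of_le
    (fun _ => norm_nonneg _) fun _ => norm_theta_term_le hh _ le_rfl

/-- Termwise differentiation of `thetaP`. -/
lemma hasSum_deriv_thetaP {b : Fin 2 → Fin 2 → ℝ} (hb : LinearIndependent ℝ b)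
    {h : (Fin 2 → ℝ) → ℝ} (hh : ∀ v, |h v| ≤ nsq v) {τ : ℂ} (hτ : 0 < τ.im) :
    HasSum (fun c : Fin 2 → ℤ => 2 * Real.pi * Complex.I *
      ((nsq (LV b c) : ℂ) * ((h (LV b c) : ℂ) * eq2 (nsq (LV b c)) τ)))
      (deriv (thetaP b h) τ) := by
  have hd (c : Fin 2 → ℤ) (w : ℂ) := (hasDerivAt_eq2 (nsq (LV b c)) w).const_mul (h (LV b c) : ℂ)
  have key := Complex.hasSum_deriv_of_summable_norm (z := τ) (U := {w : ℂ | τ.im / 2 < w.im})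
    (F := fun (c : Fin 2 → ℤ) (w : ℂ) => (h (LV b c) : ℂ) * eq2 (nsq (LV b c)) w)
    (summable_nsq_mul_exp hb (by positivity : 0 < 2 * Real.pi * (τ.im / 2)))
    (fun c w _ => (hd c w).differentiableAt.differentiableWithinAt)
    (isOpen_lt continuous_const Complex.continuous_im)
    (fun c w hw => norm_theta_term_le hh _ (le_of_lt hw)) (half_lt_self hτ)
  convert! key using 2 with c
  rw [(hd c τ).deriv]
  ring

lemma hasSum_mul_complex {ι κ : Type*} {f : ι → ℂ} {g : κ → ℂ} {s t : ℂ}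
    (hf : HasSum f s) (hg : HasSum g t) :
    HasSum (fun x : ι × κ => f x.1 * g x.2) (s * t) :=
  hf.mul hg (summable_mul_of_summable_norm hf.summable.norm hg.summable.norm)

/-- The normalized Wronskian of two theta series as a double sum. -/
lemma wronskian_thetaP {b : Fin 2 → Fin 2 → ℝ} (hb : LinearIndependent ℝ b)
    {h₁ h₂ : (Fin 2 → ℝ) → ℝ} (hh₁ : ∀ v, |h₁ v| ≤ nsq v) (hh₂ : ∀ v, |h₂ v| ≤ nsq v)
    {τ : ℂ} (hτ : 0 < τ.im) :
    HasSum (fun cd : (Fin 2 → ℤ) × (Fin 2 → ℤ) =>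
        ((h₁ (LV b cd.1) * h₂ (LV b cd.2) * (nsq (LV b cd.2) - nsq (LV b cd.1)) : ℝ) : ℂ) *
          eq2 (nsq (LV b cd.1) + nsq (LV b cd.2)) τ)
      ((1 / (2 * Real.pi * Complex.I)) *
        (thetaP b h₁ τ * deriv (thetaP b h₂) τ - deriv (thetaP b h₁) τ * thetaP b h₂ τ)) := by
  have s₁ := summable_norm_theta_term hb hh₁ hτ
  have s₂ := summable_norm_theta_term hb hh₂ hτ
  have d₁ := hasSum_deriv_thetaP hb hh₁ hτ
  have d₂ := hasSum_deriv_thetaP hb hh₂ hτ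
  have t₁ : HasSum _ (thetaP b h₁ τ) := s₁.of_norm.hasSum
  have t₂ : HasSum _ (thetaP b h₂ τ) := s₂.of_norm.hasSum
  have m₁ := hasSum_mul_complex t₁ d₂
  have m₂ := hasSum_mul_complex d₁ t₂
  refine ((m₁.sub m₂).mul_left (1 / (2 * Real.pi * Complex.I))).congr_fun fun cd => ?_
  have hpi : 1 / (2 * Real.pi * Complex.I) * (2 * Real.pi * Complex.I) = 1 :=
    one_div_mul_cancel Complex.two_pi_I_ne_zero
  rw [eq2_add]
  push_cast
  linear_combination (-(h₁ (LV b cd.1) * h₂ (LV b cd.2) * (nsq (LV b cd.2) - nsq (LV b cd.1)) *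
    (eq2 (nsq (LV b cd.1)) τ * eq2 (nsq (LV b cd.2)) τ)) : ℂ) * hpi

lemma abs_sq_sub_sq_le_nsq (v : Fin 2 → ℝ) : |v 0 ^ 2 - v 1 ^ 2| ≤ nsq v := by
  rw [nsq, Fin.sum_univ_two, abs_le]
  constructor <;> nlinarith [sq_nonneg (v 0), sq_nonneg (v 1)]

lemma abs_mul_le_nsq (v : Fin 2 → ℝ) : |v 0 * v 1| ≤ nsq v := by
  rw [nsq, Fin.sum_univ_two, abs_le]
  constructor <;> nlinarith [sq_nonneg (v 0 + v 1), sq_nonneg (v 0 - v 1)]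

lemma antisymmetrization_eq_ip_mul_det2 (v w : Fin 2 → ℝ) :
    (v 0 ^ 2 - v 1 ^ 2) * (w 0 * w 1) - (w 0 ^ 2 - w 1 ^ 2) * (v 0 * v 1) =
      ip v w * det2 v w := by
  simp only [ip, det2, Fin.sum_univ_two]
  ring

/-- For a lattice `Λ ⊂ ℝ²` and `h₁(x,y) = x² − y²`, `h₂(x,y) = xy`, on the upper half
plane one has
`(1/(2πi)) (Θ_{h₁;Λ} Θ'_{h₂;Λ} − Θ'_{h₁;Λ} Θ_{h₂;Λ})
  = (1/2) Σ_{(λ,μ) ∈ Λ×Λ} ⟨λ,μ⟩ det(λ,μ) (‖μ‖² − ‖λ‖²) q^{‖λ‖²+‖μ‖²}`. -/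
theorem wronskian_eq_symmetrized_sum
    (b : Fin 2 → Fin 2 → ℝ) (hb : LinearIndependent ℝ b) :
    ∀ τ : ℂ, 0 < τ.im →
      (1 / (2 * Real.pi * Complex.I)) *
        (thetaP b (fun v => v 0 ^ 2 - v 1 ^ 2) τ * deriv (thetaP b (fun v => v 0 * v 1)) τ
          - deriv (thetaP b (fun v => v 0 ^ 2 - v 1 ^ 2)) τ * thetaP b (fun v => v 0 * v 1) τ)
      = (1 / 2 : ℂ) *
          ∑' cd : (Fin 2 → ℤ) × (Fin 2 → ℤ),
            ((ip (LV b cd.1) (LV b cd.2) * det2 (LV b cd.1) (LV b cd.2) *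
                (nsq (LV b cd.2) - nsq (LV b cd.1)) : ℝ) : ℂ) *
              eq2 (nsq (LV b cd.1) + nsq (LV b cd.2)) τ := by
  intro τ hτ
  have hs := wronskian_thetaP hb abs_sq_sub_sq_le_nsq abs_mul_le_nsq hτ
  have hs' := (Equiv.prodComm (Fin 2 → ℤ) (Fin 2 → ℤ)).hasSum_iff.2 hs
  have hsum := (hs.add hs').congr_fun (g := fun cd : (Fin 2 → ℤ) × (Fin 2 → ℤ) =>
    ((ip (LV b cd.1) (LV b cd.2) * det2 (LV b cd.1) (LV b cd.2) *
      (nsq (LV b cd.2) - nsq (LV b cd.1)) : ℝ) : ℂ) *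
        eq2 (nsq (LV b cd.1) + nsq (LV b cd.2)) τ) fun cd => by
      simp only [Function.comp_apply, Equiv.prodComm_apply, Prod.fst_swap, Prod.snd_swap]
      rw [add_comm (nsq (LV b cd.2)), ← add_mul, ← Complex.ofReal_add,
        ← antisymmetrization_eq_ip_mul_det2]
      congr 2
      ring
  rw [hsum.tsum_eq]
  ring
end
end

section
/- Let Λ ⊂ ℝ² be a lattice spanned by vectors λ₁, λ₂ and define det DΘ_Λ(τ) = (1/2)·Σ_{(λ,μ)∈Λ×Λ} ⟨λ,μ⟩·det(λ,μ)·(‖μ‖² − ‖λ‖²)·exp(2πi(‖λ‖²+‖μ‖²)τ). If (i) ⟨λ₁,λ₂⟩ = 0, or (ii) 2⟨λ₁,λ₂⟩ = ‖λ₁‖², or (iii) ‖λ₁‖ = ‖λ₂‖, then det DΘ_Λ vanishes identically on the upper half plane. -/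
open scoped BigOperators

noncomputable section

/-- `det DΘ_Λ(τ) = (1/2) Σ_{(λ,μ) ∈ Λ×Λ} ⟨λ,μ⟩ det(λ,μ) (‖μ‖² − ‖λ‖²) q^{‖λ‖²+‖μ‖²}`
for the lattice `Λ` spanned by `b`. -/
def detDTheta (b : Fin 2 → Fin 2 → ℝ) (τ : ℂ) : ℂ :=
  (1 / 2 : ℂ) *
    ∑' cd : (Fin 2 → ℤ) × (Fin 2 → ℤ),
      ((ip (LV b cd.1) (LV b cd.2) * det2 (LV b cd.1) (LV b cd.2) *
          (nsq (LV b cd.2) - nsq (LV b cd.1)) : ℝ) : ℂ) *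
        eq2 (nsq (LV b cd.1) + nsq (LV b cd.2)) τ


theorem nsq_eq_ip_self (v : Fin 2 → ℝ) : nsq v = ip v v := by
  simp [nsq, ip, sq]

theorem ip_LV (b : Fin 2 → Fin 2 → ℝ) (c d : Fin 2 → ℤ) :
    ip (LV b c) (LV b d) = c 0 * d 0 * nsq (b 0) + (c 0 * d 1 + c 1 * d 0) * ip (b 0) (b 1)
      + c 1 * d 1 * nsq (b 1) := by
  simp only [ip, nsq, LV, Fin.sum_univ_two, Pi.add_apply, Pi.smul_apply, smul_eq_mul]
  ring

theorem det2_LV (b : Fin 2 → Fin 2 → ℝ) (c d : Fin 2 → ℤ) :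
    det2 (LV b c) (LV b d) = (c 0 * d 1 - c 1 * d 0) * det2 (b 0) (b 1) := by
  simp only [det2, LV, Fin.sum_univ_two, Pi.add_apply, Pi.smul_apply, smul_eq_mul]
  ring

/-- `det DΘ_Λ` vanishes as soon as `Λ` has an orientation-reversing isometric involution. -/
theorem detDTheta_eq_zero_of_involutive (b : Fin 2 → Fin 2 → ℝ)
    (e : (Fin 2 → ℤ) → Fin 2 → ℤ) (he : Function.Involutive e)
    (hip : ∀ c d, ip (LV b (e c)) (LV b (e d)) = ip (LV b c) (LV b d))
    (hdet : ∀ c d, det2 (LV b (e c)) (LV b (e d)) = -det2 (LV b c) (LV b d)) (τ : ℂ) :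
    detDTheta b τ = 0 := by
  have hneg : detDTheta b τ = -detDTheta b τ := by
    conv_lhs => rw [detDTheta, ← ((he.toPerm e).prodCongr (he.toPerm e)).tsum_eq]
    rw [detDTheta, ← mul_neg, ← tsum_neg]
    congr 2
    funext cd
    simp only [Equiv.prodCongr_apply, Prod.map_fst, Prod.map_snd, Function.Involutive.coe_toPerm,
      nsq_eq_ip_self, hip, hdet]
    push_cast
    ring
  exact self_eq_neg.mp hneg

/-- Let `Λ ⊂ ℝ²` be a lattice spanned by `λ₁ = b 0`, `λ₂ = b 1`.  If `⟨λ₁,λ₂⟩ = 0`, or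
`2⟨λ₁,λ₂⟩ = ‖λ₁‖²`, or `‖λ₁‖ = ‖λ₂‖`, then `det DΘ_Λ` vanishes identically on the upper
half plane. -/
theorem detDTheta_eq_zero_of_special_basis
    (b : Fin 2 → Fin 2 → ℝ) (hb : LinearIndependent ℝ b)
    (hcase : ip (b 0) (b 1) = 0 ∨ 2 * ip (b 0) (b 1) = nsq (b 0) ∨ nsq (b 0) = nsq (b 1)) :
    ∀ τ : ℂ, 0 < τ.im → detDTheta b τ = 0 := by
  intro τ _
  rcases hcase with h | h | h
  · refine detDTheta_eq_zero_of_involutive b (fun c => ![c 0, -c 1]) (fun c => ?_)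
      (fun c d => ?_) (fun c d => ?_) τ
    · ext i; fin_cases i <;> simp
    · simp [ip_LV, h]
    · simp [det2_LV]; ring
  · refine detDTheta_eq_zero_of_involutive b (fun c => ![-c 0 - c 1, c 1]) (fun c => ?_)
      (fun c d => ?_) (fun c d => ?_) τ
    · ext i; fin_cases i <;> simp
    · simp [ip_LV, ← h]; ring
    · simp [det2_LV]; ring
  · refine detDTheta_eq_zero_of_involutive b (fun c => ![c 1, c 0]) (fun c => ?_)
      (fun c d => ?_) (fun c d => ?_) τ
    · ext i; fin_cases i <;> simp
    · simp [ip_LV, h]; ring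
    · simp [det2_LV]; ring
end
end
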